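/- Let a, a': Z^d × N → (0,∞) be conductance fields with 0 < ψ(x,e) - ε ≤ a(x,e) ≤ ψ(x,e) + ε for some reference field ψ and ε > 0. Then for any event F depending only on the path of the continuous-time random walk up to time t, the probability under conductances a is at least e^{-4dεt} times the probability under conductances ψ - ε: P_0^a(F) ≥ e^{-4dεt} P_0^{ψ-ε}(F). -/

import Mathlib

open scoped ENNReal
open MeasureTheory

namespace RWRC

/-- state space ℤ^d -/
abbrev S (d : ℕ) := Fin d → ℤ

/-- total jump rate out of `x` (sum of the conductances of the 2d incident edges);
`φ x i` is the conductance of the edge from `x` to `x + e_i`. -/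
noncomputable def totalRate (d : ℕ) (φ : S d → Fin d → ℝ) (x : S d) : ℝ :=
  ∑ i : Fin d, (φ x i + φ (x - Pi.single i 1) i)

/-- jump rate from `x` to `y` (nonzero only for nearest neighbours). -/
noncomputable def jumpRate (d : ℕ) (φ : S d → Fin d → ℝ) (x y : S d) : ℝ :=
  ∑ i : Fin d, ((if y = x + Pi.single i 1 then φ x i else 0)
    + (if y = x - Pi.single i 1 then φ (x - Pi.single i 1) i else 0))

/-- sample space: the jump chain together with the holding times. -/
abbrev Ω (d : ℕ) := (ℕ → S d) × (ℕ → ℝ)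

/-- the jump chain started at 0 determined by the successive states `x`. -/
noncomputable def chain (d : ℕ) {n : ℕ} (x : Fin n → S d) : ℕ → S d :=
  fun k => if h : k - 1 < n then (if k = 0 then 0 else x ⟨k - 1, h⟩) else 0

/-- the position of the walk at time `u`. -/
noncomputable def path (d : ℕ) (ω : Ω d) (u : ℝ) : S d :=
  ω.1 (sSup {n : ℕ | ∑ i ∈ Finset.range n, ω.2 i ≤ u})

/-- `P` is the law of the continuous-time random walk among the conductances `φ`
started at 0: it is a probability measure whose cylinder probabilities are given
by the jump probabilities and exponential holding times. -/
def IsRWRCLaw (d : ℕ) (φ : S d → Fin d → ℝ) (P : Measure (Ω d)) : Prop :=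
  IsProbabilityMeasure P ∧
  ∀ (n : ℕ) (x : Fin n → S d) (s : Fin n → ℝ), (∀ i, 0 ≤ s i) →
    P {ω | ω.1 0 = 0 ∧ ∀ i : Fin n, ω.1 ((i : ℕ) + 1) = x i ∧ s i < ω.2 i}
      = ENNReal.ofReal (∏ i : Fin n,
          (jumpRate d φ (chain d x i) (x i) / totalRate d φ (chain d x i))
          * Real.exp (- totalRate d φ (chain d x i) * s i))

open Set Filter ProbabilityTheory

/-- On a standard Borel space, the outer measure of a saturated set can be computed on the
quotient. -/
theorem map_apply_le_preimage {X Y : Type*} [MeasurableSpace X] [MeasurableSpace Y]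
    [StandardBorelSpace X] [StandardBorelSpace Y] (μ : Measure X) [IsFiniteMeasure μ]
    {f : X → Y} (hf : Measurable f) (B : Set Y) : μ.map f B ≤ μ (f ⁻¹' B) := by
  rcases isEmpty_or_nonempty X with hX | hX
  · simp [Measure.eq_zero_of_isEmpty μ]
  set M := toMeasurable μ (f ⁻¹' B) with hM
  have hMm : MeasurableSet M := measurableSet_toMeasurable _ _
  have hBM : f ⁻¹' B ⊆ M := subset_toMeasurable _ _
  set κ := condDistrib (id : X → X) f μ
  have hκ : (μ.map f) ⊗ₘ κ = μ.map fun a ↦ (f a, a) :=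
    compProd_map_condDistrib aemeasurable_id
  have hgraph : ∀ᵐ y ∂(μ.map f), ∀ᵐ x ∂(κ y), f x = y := by
    apply Measure.ae_ae_of_ae_compProd (p := fun z : Y × X ↦ f z.2 = z.1)
    have hgm : MeasurableSet {z : Y × X | f z.2 = z.1} :=
      measurableSet_eq_fun (hf.comp measurable_snd) measurable_fst
    rw [hκ, ae_map_iff (by fun_prop) hgm]
    simp
  have hsub : ∀ᵐ y ∂(μ.map f), y ∈ B → 1 ≤ κ y M := by
    filter_upwards [hgraph] with y hy hyB
    have : ∀ᵐ x ∂(κ y), x ∈ M := by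
      filter_upwards [hy] with x hx
      exact hBM (by simpa [hx] using hyB)
    rw [prob_compl_eq_zero_iff hMm |>.1 (by simpa [ae_iff] using! this)]
  have hms : MeasurableSet {y | 1 ≤ κ y M} :=
    measurableSet_le measurable_const (κ.measurable_coe hMm)
  calc μ.map f B ≤ μ.map f {y | 1 ≤ κ y M} := measure_mono_ae hsub
    _ = ∫⁻ y in {y | 1 ≤ κ y M}, 1 ∂(μ.map f) := by simp
    _ ≤ ∫⁻ y in {y | 1 ≤ κ y M}, κ y M ∂(μ.map f) :=
        setLIntegral_mono (κ.measurable_coe hMm) fun y hy ↦ hy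
    _ ≤ ∫⁻ y, κ y M ∂(μ.map f) := setLIntegral_le_lintegral _ _
    _ = ((μ.map f) ⊗ₘ κ) (Prod.snd ⁻¹' M) := by
        rw [Measure.compProd_apply (measurable_snd hMm)]; rfl
    _ = μ M := by
        rw [hκ, Measure.map_apply (by fun_prop) (measurable_snd hMm)]; rfl
    _ = μ (f ⁻¹' B) := measure_toMeasurable _

/-- An inequality between finite measures may be checked on a generating algebra. -/
theorem measure_le_of_isSetAlgebra {X : Type*} {mX : MeasurableSpace X} {μ ν : Measure X}
    [IsFiniteMeasure μ] [IsFiniteMeasure ν] {C : Set (Set X)} (hC : IsSetAlgebra C)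
    (hgen : mX = MeasurableSpace.generateFrom C) (h : ∀ s ∈ C, μ s ≤ ν s) : μ ≤ ν := by
  refine Measure.le_iff.2 fun s hs ↦ ENNReal.le_of_forall_pos_le_add fun ε hε _ ↦ ?_
  have hε' : (0 : ℝ≥0∞) < ε / 2 := by simpa using hε.ne'
  obtain ⟨t, htC, ht⟩ := exists_measure_symmDiff_lt_of_generateFrom_isSetRing (μ := μ + ν)
    hC.isSetRing ⟨{univ}, by simp, by simpa using hC.univ_mem, by simp⟩ hgen hs hε'
  rw [Measure.add_apply] at ht
  have h1 : μ s ≤ μ t + μ (symmDiff t s) :=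
    (measure_mono (fun x hx ↦ by
      by_cases hxt : x ∈ t
      · exact Or.inl hxt
      · exact Or.inr (Or.inr ⟨hx, hxt⟩))).trans (measure_union_le _ _)
  have h2 : ν t ≤ ν s + ν (symmDiff t s) :=
    (measure_mono (fun x hx ↦ by
      by_cases hxs : x ∈ s
      · exact Or.inl hxs
      · exact Or.inr (Or.inl ⟨hx, hxs⟩))).trans (measure_union_le _ _)
  calc μ s ≤ μ t + μ (symmDiff t s) := h1
    _ ≤ ν t + μ (symmDiff t s) := add_le_add_left (h t htC) _
    _ ≤ ν s + ν (symmDiff t s) + μ (symmDiff t s) := by gcongr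
    _ = ν s + (μ (symmDiff t s) + ν (symmDiff t s)) := by ring
    _ ≤ ν s + ε := by gcongr; exact ht.le.trans ENNReal.half_le_self

/-- The measure on states whose mass at `y` is the jump rate from `x` to `y`. -/
noncomputable def jumpMeasure (d : ℕ) (φ : S d → Fin d → ℝ) (x : S d) : Measure (S d) :=
  ∑ i : Fin d, (ENNReal.ofReal (φ x i) • Measure.dirac (x + Pi.single i 1)
    + ENNReal.ofReal (φ (x - Pi.single i 1) i) • Measure.dirac (x - Pi.single i 1))

/-- The measure with density `s ↦ exp (-r * s)` on `[0, ∞)`. -/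
noncomputable def holdingMeasure (r : ℝ) : Measure ℝ :=
  (volume.restrict (Ici 0)).withDensity fun s ↦ ENNReal.ofReal (Real.exp (-r * s))

/-- Joint law of the next state and the holding time of the walk at `x`. -/
noncomputable def stepMeasure (d : ℕ) (φ : S d → Fin d → ℝ) (x : S d) : Measure (S d × ℝ) :=
  (jumpMeasure d φ x).prod (holdingMeasure (totalRate d φ x))

instance (d : ℕ) (φ : S d → Fin d → ℝ) (x : S d) : IsFiniteMeasure (jumpMeasure d φ x) := by
  unfold jumpMeasure
  have (i : Fin d) : IsFiniteMeasure (ENNReal.ofReal (φ x i) • Measure.dirac (x + Pi.single i 1)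
      + ENNReal.ofReal (φ (x - Pi.single i 1) i) • Measure.dirac (x - Pi.single i 1)) := by
    have := Measure.smul_finite (Measure.dirac (x + Pi.single i (1 : ℤ)))
      (ENNReal.ofReal_ne_top (r := φ x i))
    have := Measure.smul_finite (Measure.dirac (x - Pi.single i (1 : ℤ)))
      (ENNReal.ofReal_ne_top (r := φ (x - Pi.single i 1) i))
    infer_instance
  infer_instance

instance (r : ℝ) : SFinite (holdingMeasure r) := by
  unfold holdingMeasure; infer_instance

theorem jumpMeasure_mono {d : ℕ} {φ φ' : S d → Fin d → ℝ} (h : ∀ x i, φ x i ≤ φ' x i) (x : S d) :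
    jumpMeasure d φ x ≤ jumpMeasure d φ' x := by
  refine Measure.le_iff.2 fun s _ ↦ ?_
  simp only [jumpMeasure, Measure.finsetSum_apply, Measure.add_apply, Measure.smul_apply,
    smul_eq_mul]
  gcongr <;> exact h _ _

section Positive

variable {d : ℕ} {φ : S d → Fin d → ℝ}

theorem totalRate_pos (hd : 1 ≤ d) (hφ : ∀ x i, 0 < φ x i) (x : S d) : 0 < totalRate d φ x :=
  have : Nonempty (Fin d) := ⟨⟨0, hd⟩⟩
  Finset.sum_pos (fun _ _ ↦ add_pos (hφ _ _) (hφ _ _)) Finset.univ_nonempty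

theorem jumpRate_nonneg (hφ : ∀ x i, 0 < φ x i) (x y : S d) : 0 ≤ jumpRate d φ x y :=
  Finset.sum_nonneg fun i _ ↦ by
    have := (hφ x i).le
    have := (hφ (x - Pi.single i 1) i).le
    split_ifs <;> simp <;> linarith

theorem jumpMeasure_univ (hφ : ∀ x i, 0 < φ x i) (x : S d) :
    jumpMeasure d φ x univ = ENNReal.ofReal (totalRate d φ x) := by
  rw [totalRate, ENNReal.ofReal_sum_of_nonneg fun _ _ ↦ (add_pos (hφ _ _) (hφ _ _)).le]
  simp [jumpMeasure, Measure.finsetSum_apply, ENNReal.ofReal_add, (hφ _ _).le]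

theorem jumpMeasure_singleton (hφ : ∀ x i, 0 < φ x i) (x y : S d) :
    jumpMeasure d φ x {y} = ENNReal.ofReal (jumpRate d φ x y) := by
  rw [jumpRate, ENNReal.ofReal_sum_of_nonneg]
  · simp only [jumpMeasure, Measure.finsetSum_apply, Measure.add_apply, Measure.smul_apply,
      smul_eq_mul]
    refine Finset.sum_congr rfl fun i _ ↦ ?_
    rw [ENNReal.ofReal_add]
    · congr 1
      · by_cases h : y = x + Pi.single i 1
        · simp [h]
        · simp [h, Ne.symm h]
      · by_cases h : y = x - Pi.single i 1
        · simp [h]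
        · simp [h, Ne.symm h]
    · have := (hφ x i).le
      split_ifs <;> simp [this]
    · have := (hφ (x - Pi.single i 1) i).le
      split_ifs <;> simp [this]
  · intro i _
    have := (hφ x i).le
    have := (hφ (x - Pi.single i 1) i).le
    split_ifs <;> simp <;> linarith

theorem setLIntegral_exp_Ioi {r : ℝ} (hr : 0 < r) (τ : ℝ) :
    ∫⁻ s in Ioi τ, ENNReal.ofReal (Real.exp (-r * s))
      = ENNReal.ofReal (Real.exp (-r * τ) / r) := by
  have hneg : -r < 0 := by linarith
  rw [← ofReal_integral_eq_lintegral_ofReal (integrableOn_exp_mul_Ioi hneg τ)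
    (Eventually.of_forall fun _ ↦ (Real.exp_pos _).le), integral_exp_mul_Ioi hneg, neg_div_neg_eq]

theorem lintegral_holdingMeasure (r : ℝ) {v : ℝ → ℝ≥0∞} (hv : Measurable v) :
    ∫⁻ s, v s ∂(holdingMeasure r)
      = ∫⁻ s in Ici 0, ENNReal.ofReal (Real.exp (-r * s)) * v s := by
  rw [holdingMeasure, lintegral_withDensity_eq_lintegral_mul _ (by fun_prop) hv]
  rfl

theorem holdingMeasure_Ioi {r : ℝ} (hr : 0 < r) (s : ℝ) :
    holdingMeasure r (Ioi s) = ENNReal.ofReal (Real.exp (-r * max s 0) / r) := by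
  rw [holdingMeasure, withDensity_apply _ measurableSet_Ioi,
    Measure.restrict_restrict measurableSet_Ioi, ← setLIntegral_exp_Ioi hr]
  refine setLIntegral_congr ?_
  have h1 : (Ioi s ∩ Ici 0 : Set ℝ) =ᵐ[volume] (Ioi s ∩ Ioi 0 : Set ℝ) :=
    (ae_eq_refl _).inter Ioi_ae_eq_Ici.symm
  rwa [Ioi_inter_Ioi] at h1

theorem lintegral_holdingMeasure_of_eq_const {r : ℝ} (hr : 0 < r) {v : ℝ → ℝ≥0∞}
    (hv : Measurable v) {τ : ℝ} (hτ : 0 ≤ τ) {γ : ℝ≥0∞} (hγ : ∀ s, τ < s → v s = γ) :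
    ∫⁻ s, v s ∂(holdingMeasure r)
      = (∫⁻ s in Icc 0 τ, ENNReal.ofReal (Real.exp (-r * s)) * v s)
        + ENNReal.ofReal (Real.exp (-r * τ) / r) * γ := by
  rw [lintegral_holdingMeasure r hv, ← Icc_union_Ioi_eq_Ici hτ,
    lintegral_union measurableSet_Ioi
      (Set.disjoint_left.2 fun s hs hs' ↦ (not_lt.2 hs.2) hs')]
  congr 1
  rw [← setLIntegral_exp_Ioi hr, ← lintegral_mul_const _ (by fun_prop)]
  exact setLIntegral_congr_fun measurableSet_Ioi fun s hs ↦ by simp only [hγ s hs]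

theorem lintegral_stepMeasure_of_eq_const (hd : 1 ≤ d) (hφ : ∀ x i, 0 < φ x i) (x : S d)
    {v : S d × ℝ → ℝ≥0∞} (hv : Measurable v) {τ : ℝ} (hτ : 0 ≤ τ) {γ : ℝ≥0∞}
    (hγ : ∀ y s, τ < s → v (y, s) = γ) :
    ∫⁻ p, v p ∂(stepMeasure d φ x)
      = (∫⁻ y, (∫⁻ s in Icc 0 τ, ENNReal.ofReal (Real.exp (-totalRate d φ x * s)) * v (y, s))
          ∂(jumpMeasure d φ x))
        + ENNReal.ofReal (Real.exp (-totalRate d φ x * τ)) * γ := by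
  have hr := totalRate_pos hd hφ x
  rw [stepMeasure, lintegral_prod _ hv.aemeasurable]
  rw [lintegral_congr fun y ↦ lintegral_holdingMeasure_of_eq_const hr
    (v := fun s ↦ v (y, s)) (by fun_prop) hτ (hγ y),
    lintegral_add_right _ measurable_const, lintegral_const, jumpMeasure_univ hφ,
    mul_right_comm, ← ENNReal.ofReal_mul (by positivity), div_mul_cancel₀ _ hr.ne']

theorem stepMeasure_prod_Ioi (hd : 1 ≤ d) (hφ : ∀ x i, 0 < φ x i) (x y : S d) (s : ℝ) :
    stepMeasure d φ x ({y} ×ˢ Ioi s) = ENNReal.ofReal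
      (jumpRate d φ x y / totalRate d φ x * Real.exp (-totalRate d φ x * max s 0)) := by
  rw [stepMeasure, Measure.prod_prod, jumpMeasure_singleton hφ,
    holdingMeasure_Ioi (totalRate_pos hd hφ x), ← ENNReal.ofReal_mul (jumpRate_nonneg hφ x y)]
  congr 1
  ring

theorem isProbabilityMeasure_stepMeasure (hd : 1 ≤ d) (hφ : ∀ x i, 0 < φ x i) (x : S d) :
    IsProbabilityMeasure (stepMeasure d φ x) := by
  constructor
  have h := lintegral_stepMeasure_of_eq_const hd hφ x (v := fun _ ↦ 1) measurable_const le_rfl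
    (fun _ _ _ ↦ rfl)
  simpa using h

theorem ae_stepMeasure_pos (d : ℕ) (φ : S d → Fin d → ℝ) (x : S d) :
    ∀ᵐ p ∂(stepMeasure d φ x), 0 < p.2 := by
  have h : ∀ᵐ s ∂(holdingMeasure (totalRate d φ x)), 0 < s := by
    refine (withDensity_absolutelyContinuous _ _).ae_le ?_
    rw [← restrict_Ioi_eq_restrict_Ici]
    exact ae_restrict_mem measurableSet_Ioi
  exact Measure.quasiMeasurePreserving_snd.ae h

end Positive

/-- One-step comparison of two walks, for observables which do not see what happens after
time `τ`. -/
theorem lintegral_stepMeasure_le {d : ℕ} {a b : S d → Fin d → ℝ} (hd : 1 ≤ d)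
    (hb : ∀ x i, 0 < b x i) (hba : ∀ x i, b x i ≤ a x i) {c : ℝ} {x : S d}
    (hc : totalRate d a x ≤ totalRate d b x + c)
    {v : S d × ℝ → ℝ≥0∞} (hv : Measurable v) {τ : ℝ} (hτ : 0 ≤ τ) {γ : ℝ≥0∞}
    (hγ : ∀ y s, τ < s → v (y, s) = γ) :
    ∫⁻ p, v p ∂(stepMeasure d b x)
      ≤ ∫⁻ p, ENNReal.ofReal (Real.exp (c * min p.2 τ)) * v p ∂(stepMeasure d a x) := by
  have key (s : ℝ) (hs : 0 ≤ s) : ENNReal.ofReal (Real.exp (-totalRate d b x * s))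
      ≤ ENNReal.ofReal (Real.exp (-totalRate d a x * s)) * ENNReal.ofReal (Real.exp (c * s)) := by
    rw [← ENNReal.ofReal_mul (Real.exp_pos _).le, ← Real.exp_add]
    gcongr
    nlinarith
  rw [lintegral_stepMeasure_of_eq_const hd hb x hv hτ hγ,
    lintegral_stepMeasure_of_eq_const hd (fun x i ↦ (hb x i).trans_le (hba x i)) x
      (by fun_prop) hτ (γ := ENNReal.ofReal (Real.exp (c * τ)) * γ)
      (fun y s hs ↦ by simp only [hγ y s hs, min_eq_right hs.le])]
  refine add_le_add ?_ ?_
  · refine lintegral_mono' (jumpMeasure_mono hba x) fun y ↦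
      setLIntegral_mono' measurableSet_Icc fun s hs ↦ ?_
    rw [min_eq_left hs.2, ← mul_assoc]
    gcongr
    exact key s hs.1
  · rw [← mul_assoc]
    gcongr
    exact key τ hτ

/-- Trajectories recorded as the successive states (after the initial one, which is `0`) together
with the holding times. -/
abbrev Traj (d : ℕ) := ℕ → S d × ℝ

/-- The state after `n` jumps. -/
def Traj.state {d : ℕ} (y : Traj d) : ℕ → S d
  | 0 => 0
  | n + 1 => (y n).1

/-- The time of the `n`-th jump; negative holding times count as zero. -/
noncomputable def Traj.clock {d : ℕ} (y : Traj d) (n : ℕ) : ℝ :=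
  ∑ i ∈ Finset.range n, max (y i).2 0

section Traj

variable {d : ℕ}

@[fun_prop]
theorem measurable_state (n : ℕ) : Measurable fun y : Traj d ↦ y.state n := by
  cases n with
  | zero => exact measurable_const
  | succ n => exact (measurable_pi_apply n).fst

@[fun_prop]
theorem measurable_clock (n : ℕ) : Measurable fun y : Traj d ↦ y.clock n :=
  Finset.measurable_sum _ fun i _ ↦ ((measurable_pi_apply i).snd).max measurable_const

@[fun_prop]
theorem measurable_update_traj (n : ℕ) :
    Measurable fun z : Traj d × (S d × ℝ) ↦ Function.update z.1 n z.2 := by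
  refine measurable_pi_iff.2 fun k ↦ ?_
  rcases eq_or_ne k n with rfl | h
  · simpa using measurable_snd
  · simp only [Function.update_of_ne h]
    exact (measurable_pi_apply k).comp measurable_fst

theorem clock_mono (y : Traj d) : Monotone y.clock := fun _ _ h ↦
  Finset.sum_le_sum_of_subset_of_nonneg (Finset.range_mono h) fun _ _ _ ↦ le_max_right _ _

theorem clock_zero (y : Traj d) : y.clock 0 = 0 := Finset.sum_range_zero _

theorem clock_succ (y : Traj d) (n : ℕ) : y.clock (n + 1) = y.clock n + max (y n).2 0 :=
  Finset.sum_range_succ _ _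

theorem clock_congr {y y' : Traj d} {n : ℕ} (h : ∀ k < n, y k = y' k) :
    y.clock n = y'.clock n :=
  Finset.sum_congr rfl fun i hi ↦ by rw [h i (Finset.mem_range.1 hi)]

theorem state_congr {y y' : Traj d} {n : ℕ} (h : ∀ k < n, y k = y' k) :
    y.state n = y'.state n := by
  cases n with
  | zero => rfl
  | succ n => simp [Traj.state, h n n.lt_succ_self]

theorem clock_update (y : Traj d) {k n : ℕ} (h : k ≤ n) (p : S d × ℝ) :
    Traj.clock (Function.update y n p) k = y.clock k :=
  clock_congr fun j hj ↦ Function.update_of_ne (by omega) _ _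

theorem clock_update_succ (y : Traj d) (n : ℕ) (p : S d × ℝ) :
    Traj.clock (Function.update y n p) (n + 1) = y.clock n + max p.2 0 := by
  rw [clock_succ, clock_update y le_rfl, Function.update_self]

/-- `y` and `y'` have the same jumps, among the first `n`, up to time `t`. -/
def AgreeUpTo (t : ℝ) (n : ℕ) (y y' : Traj d) : Prop :=
  ∀ k < n, y.clock (k + 1) ≤ t ∨ y'.clock (k + 1) ≤ t → y k = y' k

theorem AgreeUpTo.symm {t : ℝ} {n : ℕ} {y y' : Traj d} (h : AgreeUpTo t n y y') :
    AgreeUpTo t n y' y := fun k hk hc ↦ (h k hk hc.symm).symm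

theorem AgreeUpTo.apply_eq {t : ℝ} {n m : ℕ} {y y' : Traj d} (h : AgreeUpTo t n y y')
    (hmn : m ≤ n) (hm : y.clock m ≤ t) : ∀ k < m, y k = y' k := fun k hk ↦
  h k (by omega) (Or.inl ((clock_mono y (by omega)).trans hm))

theorem AgreeUpTo.update {t : ℝ} {n : ℕ} {y y' : Traj d} (h : AgreeUpTo t n y y')
    (ht : t < y.clock n) (p p' : S d × ℝ) :
    AgreeUpTo t (n + 1) (Function.update y n p) (Function.update y' n p') := by
  have ht' : t < y'.clock n := by
    by_contra! hcon
    rw [clock_congr (h.symm.apply_eq le_rfl hcon)] at hcon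
    exact absurd hcon (not_le.2 ht)
  intro k hk hc
  rcases Nat.lt_succ_iff_lt_or_eq.1 hk with hk | rfl
  · rw [clock_update y hk, clock_update y' hk] at hc
    rw [Function.update_of_ne hk.ne, Function.update_of_ne hk.ne]
    exact h k hk hc
  · rw [clock_update_succ, clock_update_succ] at hc
    have := le_max_right p.2 0
    have := le_max_right p'.2 0
    rcases hc with hc | hc <;> linarith

/-- The transition kernel of the `n`-th step. -/
noncomputable def stepKernel (φ : S d → Fin d → ℝ) (n : ℕ) : Kernel (Traj d) (S d × ℝ) where
  toFun y := stepMeasure d φ (y.state n)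
  measurable' := (Measurable.of_discrete (f := stepMeasure d φ)).comp (measurable_state n)

/-- The law of the first `n` steps of the walk, the other coordinates being set to `0`. -/
noncomputable def walkMeasure (φ : S d → Fin d → ℝ) : ℕ → Measure (Traj d)
  | 0 => Measure.dirac 0
  | n + 1 => (walkMeasure φ n ⊗ₘ stepKernel φ n).map fun z ↦ Function.update z.1 n z.2

variable {φ : S d → Fin d → ℝ}

theorem isMarkovKernel_stepKernel (hd : 1 ≤ d) (hφ : ∀ x i, 0 < φ x i) (n : ℕ) :
    IsMarkovKernel (stepKernel φ n) :=
  ⟨fun y ↦ isProbabilityMeasure_stepMeasure hd hφ (y.state n)⟩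

theorem isProbabilityMeasure_walkMeasure (hd : 1 ≤ d) (hφ : ∀ x i, 0 < φ x i) (n : ℕ) :
    IsProbabilityMeasure (walkMeasure φ n) := by
  induction n with
  | zero => exact Measure.dirac.isProbabilityMeasure
  | succ n ih =>
    have := isMarkovKernel_stepKernel hd hφ n
    exact Measure.isProbabilityMeasure_map (by fun_prop)

theorem lintegral_walkMeasure_succ (hd : 1 ≤ d) (hφ : ∀ x i, 0 < φ x i) (n : ℕ)
    {g : Traj d → ℝ≥0∞} (hg : Measurable g) :
    ∫⁻ y, g y ∂(walkMeasure φ (n + 1)) = ∫⁻ y, ∫⁻ p, g (Function.update y n p)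
      ∂(stepMeasure d φ (y.state n)) ∂(walkMeasure φ n) := by
  have := isMarkovKernel_stepKernel hd hφ n
  have := isProbabilityMeasure_walkMeasure hd hφ n
  rw [walkMeasure, lintegral_map hg (by fun_prop), Measure.lintegral_compProd (by fun_prop)]
  rfl

theorem walkMeasure_cylinder (hd : 1 ≤ d) (hφ : ∀ x i, 0 < φ x i) (X : Traj d) (n : ℕ) :
    walkMeasure φ n {y | ∀ k < n, (y k).1 = (X k).1 ∧ (X k).2 < (y k).2}
      = ENNReal.ofReal (∏ k ∈ Finset.range n,
        (jumpRate d φ (X.state k) (X.state (k + 1)) / totalRate d φ (X.state k)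
          * Real.exp (-totalRate d φ (X.state k) * max (X k).2 0))) := by
  have hmeas (n : ℕ) :
      MeasurableSet {y : Traj d | ∀ k < n, (y k).1 = (X k).1 ∧ (X k).2 < (y k).2} := by
    simp only [Set.ofPred_forall]
    refine MeasurableSet.iInter fun k ↦ MeasurableSet.iInter fun _ ↦ ?_
    have h1 : MeasurableSet {y : Traj d | (y k).1 = (X k).1} :=
      (measurable_fst.comp (measurable_pi_apply k)) (measurableSet_singleton (X k).1)
    have h2 : MeasurableSet {y : Traj d | (X k).2 < (y k).2} :=
      measurableSet_lt measurable_const (by fun_prop)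
    exact h1.inter h2
  induction n with
  | zero =>
    have := isProbabilityMeasure_walkMeasure hd hφ 0
    simp
  | succ n ih =>
    rw [← lintegral_indicator_one (hmeas _),
      lintegral_walkMeasure_succ hd hφ n (measurable_one.indicator (hmeas _)),
      Finset.prod_range_succ, ENNReal.ofReal_mul, ← ih, mul_comm,
      ← stepMeasure_prod_Ioi hd hφ, ← lintegral_indicator_const (hmeas n)]
    · refine lintegral_congr fun y ↦ ?_
      by_cases hy : ∀ k < n, (y k).1 = (X k).1 ∧ (X k).2 < (y k).2
      · have hst : y.state n = X.state n := by
          cases n with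
          | zero => rfl
          | succ n => exact (hy n n.lt_succ_self).1
        rw [indicator_of_mem (by exact hy), hst, ← lintegral_indicator_one
          ((measurableSet_singleton _).prod measurableSet_Ioi)]
        refine lintegral_congr fun p ↦ ?_
        refine indicator_eq_indicator ?_ rfl
        simp only [mem_ofPred_eq, mem_prod, mem_singleton_iff, mem_Ioi, Traj.state]
        constructor
        · intro h
          simpa using h n n.lt_succ_self
        · intro h k hk
          rcases Nat.lt_succ_iff_lt_or_eq.1 hk with hk | rfl
          · simpa [hk.ne] using hy k hk
          · simpa using h
      · rw [indicator_of_notMem (by exact hy)]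
        refine (lintegral_congr fun p ↦ indicator_of_notMem (fun h ↦ hy fun k hk ↦ ?_) _).trans
          lintegral_zero
        simpa [hk.ne] using h k (hk.trans n.lt_succ_self)
    · exact Finset.prod_nonneg fun k _ ↦ mul_nonneg (div_nonneg (jumpRate_nonneg hφ _ _)
        (totalRate_pos hd hφ _).le) (Real.exp_pos _).le

/-- Comparison of two walks on events which only depend on what happens up to time `t`. -/
theorem lintegral_walkMeasure_le {a b : S d → Fin d → ℝ} (hd : 1 ≤ d)
    (hb : ∀ x i, 0 < b x i) (hba : ∀ x i, b x i ≤ a x i) {c t : ℝ} (ht : 0 ≤ t)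
    (hc : ∀ x, totalRate d a x ≤ totalRate d b x + c) (n : ℕ) {g : Traj d → ℝ≥0∞}
    (hg : Measurable g) (hgt : ∀ y y', AgreeUpTo t n y y' → g y = g y') :
    ∫⁻ y, g y ∂(walkMeasure b n)
      ≤ ∫⁻ y, ENNReal.ofReal (Real.exp (c * min t (y.clock n))) * g y ∂(walkMeasure a n) := by
  have ha (x i) : 0 < a x i := (hb x i).trans_le (hba x i)
  induction n generalizing g with
  | zero => simp [clock_zero, ht, walkMeasure]
  | succ n ih =>
    set w : Traj d × (S d × ℝ) → ℝ≥0∞ := fun z ↦ ENNReal.ofReal (Real.exp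
      (c * (min t (z.1.clock n + max z.2.2 0) - min t (z.1.clock n)))) with hw
    have hwm : Measurable w := by fun_prop
    set G : Traj d → ℝ≥0∞ := fun y ↦
      ∫⁻ p, w (y, p) * g (Function.update y n p) ∂(stepMeasure d a (y.state n)) with hG
    have hka := isMarkovKernel_stepKernel hd ha n
    have hGm : Measurable G :=
      Measurable.lintegral_kernel_prod_right' (κ := stepKernel a n)
        (f := fun z : Traj d × (S d × ℝ) ↦ w z * g (Function.update z.1 n z.2)) (by fun_prop)
    have hw1 (y : Traj d) (hy : t < y.clock n) (p : S d × ℝ) : w (y, p) = 1 := by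
      have := le_max_right p.2 0
      simp [hw, min_eq_left hy.le, min_eq_left (show t ≤ y.clock n + max p.2 0 by linarith)]
    have hGconst (y : Traj d) (hy : t < y.clock n) (γ : ℝ≥0∞)
        (hγ : ∀ p, g (Function.update y n p) = γ) : G y = γ := by
      have := isProbabilityMeasure_stepMeasure hd ha (y.state n)
      simp [hG, hw1 y hy, hγ]
    have hGt (y y') (hyy : AgreeUpTo t n y y') : G y = G y' := by
      rcases le_or_gt (y.clock n) t with hy | hy
      · have heq := hyy.apply_eq le_rfl hy
        simp only [hG, hw, clock_congr heq, state_congr heq]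
        refine lintegral_congr fun p ↦ ?_
        congr 1
        refine hgt _ _ fun k hk _ ↦ ?_
        rcases Nat.lt_succ_iff_lt_or_eq.1 hk with hk | rfl
        · simp [hk.ne, heq k hk]
        · simp
      · have hy' : t < y'.clock n := by
          by_contra! hcon
          rw [clock_congr (hyy.symm.apply_eq le_rfl hcon)] at hcon
          exact absurd hcon (not_le.2 hy)
        rw [hGconst y hy (g (Function.update y n 0)) fun p ↦
            hgt _ _ (AgreeUpTo.update (fun _ _ _ ↦ rfl) hy _ _),
          hGconst y' hy' (g (Function.update y n 0)) fun p ↦ hgt _ _ (hyy.symm.update hy' _ _)]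
    have hstep (y : Traj d) :
        ∫⁻ p, g (Function.update y n p) ∂(stepMeasure d b (y.state n)) ≤ G y := by
      rcases le_or_gt (y.clock n) t with hy | hy
      · refine (lintegral_stepMeasure_le hd hb hba (hc _)
          (v := fun p ↦ g (Function.update y n p)) (by fun_prop) (sub_nonneg.2 hy)
          (γ := g (Function.update y n (0, t - y.clock n + 1))) ?_).trans ?_
        · intro z s hs
          refine hgt _ _ fun k hk hcl ↦ ?_
          rcases Nat.lt_succ_iff_lt_or_eq.1 hk with hk | rfl
          · simp [hk.ne]
          · simp only [clock_update_succ] at hcl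
            have := le_max_left s 0
            have := le_max_left (t - y.clock k + 1) 0
            rcases hcl with hcl | hcl <;> linarith
        · refine lintegral_mono_ae ?_
          filter_upwards [ae_stepMeasure_pos d a (y.state n)] with p hp
          refine mul_le_mul_left (le_of_eq ?_) _
          simp only [hw, max_eq_left hp.le, min_eq_right hy]
          congr 3
          rw [min_comm, ← min_sub_sub_right, add_sub_cancel_left]
      · have := isProbabilityMeasure_stepMeasure hd hb (y.state n)
        have hconst (p) : g (Function.update y n p) = g (Function.update y n 0) :=
          hgt _ _ (AgreeUpTo.update (fun _ _ _ ↦ rfl) hy _ _)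
        rw [hGconst y hy _ hconst]
        simp [hconst]
    rw [lintegral_walkMeasure_succ hd hb n hg]
    refine (lintegral_mono hstep).trans ((ih hGm hGt).trans (le_of_eq ?_))
    rw [lintegral_walkMeasure_succ hd ha n (by fun_prop)]
    refine lintegral_congr fun y ↦ ?_
    rw [← lintegral_const_mul _ (by fun_prop)]
    refine lintegral_congr fun p ↦ ?_
    rw [← mul_assoc, ← ENNReal.ofReal_mul (Real.exp_pos _).le, ← Real.exp_add, ← mul_add,
      add_sub_cancel, clock_update_succ]

end Traj

/-- The trajectory recorded by a sample point. -/
def traj {d : ℕ} (ω : Ω d) : Traj d := fun k ↦ (ω.1 (k + 1), ω.2 k)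

/-- The sample point, started at `0`, which records a given trajectory. -/
def Traj.toΩ {d : ℕ} (y : Traj d) : Ω d := (y.state, fun k ↦ (y k).2)

/-- The trajectory `y` with all jumps after time `t` replaced by dummy jumps, the first of which
occurs after time `t`. -/
noncomputable def Traj.trunc {d : ℕ} (t : ℝ) (y : Traj d) : Traj d :=
  fun k ↦ if y.clock (k + 1) ≤ t then y k else (0, t + 1)

section Law

variable {d : ℕ} {φ : S d → Fin d → ℝ}

@[fun_prop]
theorem measurable_traj : Measurable (traj : Ω d → Traj d) := by
  unfold traj; fun_prop

@[fun_prop]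
theorem measurable_trunc (t : ℝ) : Measurable (Traj.trunc t : Traj d → Traj d) :=
  measurable_pi_iff.2 fun k ↦ Measurable.ite
    (measurableSet_le (measurable_clock (k + 1)) measurable_const)
    (measurable_pi_apply k) measurable_const

/-- Boxes `{x} × (s, ∞)`. -/
def stateTimeBoxes (d : ℕ) : Set (Set (S d × ℝ)) :=
  image2 (· ×ˢ ·) (range singleton) (range Ioi)

theorem isPiSystem_stateTimeBoxes : IsPiSystem (stateTimeBoxes d) := by
  refine IsPiSystem.prod ?_ ?_
  · rintro _ ⟨x, rfl⟩ _ ⟨y, rfl⟩ ⟨z, hzx, hzy⟩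
    obtain rfl : z = x := hzx
    obtain rfl : z = y := hzy
    exact ⟨z, (inter_self _).symm⟩
  · rintro _ ⟨r, rfl⟩ _ ⟨s, rfl⟩ -
    exact ⟨max r s, Ioi_inter_Ioi.symm⟩

theorem isCountablySpanning_range_singleton :
    IsCountablySpanning (range (singleton : S d → Set (S d))) := by
  obtain ⟨f, hf⟩ := exists_surjective_nat (S d)
  refine ⟨fun n ↦ {f n}, fun n ↦ ⟨f n, rfl⟩, eq_univ_of_forall fun x ↦ ?_⟩
  obtain ⟨n, rfl⟩ := hf x
  exact mem_iUnion.2 ⟨n, rfl⟩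

theorem isCountablySpanning_range_Ioi : IsCountablySpanning (range (Ioi : ℝ → Set ℝ)) := by
  refine ⟨fun n : ℕ ↦ Ioi (-(n : ℝ)), fun n ↦ ⟨_, rfl⟩, eq_univ_of_forall fun x ↦ ?_⟩
  obtain ⟨n, hn⟩ := exists_nat_gt (-x)
  exact mem_iUnion.2 ⟨n, neg_lt.1 hn⟩

theorem isCountablySpanning_stateTimeBoxes : IsCountablySpanning (stateTimeBoxes d) :=
  isCountablySpanning_range_singleton.prod isCountablySpanning_range_Ioi

theorem generateFrom_stateTimeBoxes :
    MeasurableSpace.generateFrom (stateTimeBoxes d) = Prod.instMeasurableSpace := by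
  refine generateFrom_eq_prod ?_ ?_ isCountablySpanning_range_singleton
    isCountablySpanning_range_Ioi
  · refine le_antisymm (MeasurableSpace.generateFrom_le ?_) fun s _ ↦ ?_
    · rintro _ ⟨x, rfl⟩
      exact measurableSet_singleton x
    · rw [← biUnion_of_singleton s]
      exact MeasurableSet.biUnion s.to_countable fun x _ ↦
        MeasurableSpace.measurableSet_generateFrom ⟨x, rfl⟩
  · rw [← borel_eq_generateFrom_Ioi, BorelSpace.measurable_eq (α := ℝ)]

theorem chain_eq_state (X : Traj d) {n k : ℕ} (hk : k < n) :
    chain d (fun i : Fin n ↦ (X i).1) k = X.state k := by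
  cases k with
  | zero => simp [chain, Traj.state]
  | succ k => simp [chain, Traj.state, show k < n by omega]

theorem IsRWRCLaw.map_restrict {P : Measure (Ω d)} (hP : IsRWRCLaw d φ P) (hd : 1 ≤ d)
    (hφ : ∀ x i, 0 < φ x i) (n : ℕ) :
    (P.restrict {ω | ω.1 0 = 0 ∧ ∀ i : Fin n, 0 < ω.2 i}).map (fun ω (i : Fin n) ↦ traj ω i)
      = (walkMeasure φ n).map fun y (i : Fin n) ↦ y i := by
  have := hP.1
  have hspan : IsCountablySpanning
      (univ.pi '' univ.pi fun _ : Fin n ↦ stateTimeBoxes d) :=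
    IsCountablySpanning.pi fun _ ↦ isCountablySpanning_stateTimeBoxes
  obtain ⟨B, hBC, hBU⟩ := hspan
  refine Measure.ext_of_generateFrom_of_iUnion _ B
    (generateFrom_eq_pi (fun _ ↦ generateFrom_stateTimeBoxes)
      fun _ ↦ isCountablySpanning_stateTimeBoxes).symm
    (IsPiSystem.pi fun _ ↦ isPiSystem_stateTimeBoxes) hBU hBC (fun _ ↦ measure_ne_top _ _) ?_
  rintro _ ⟨T, hT, rfl⟩
  have hT' (i : Fin n) : ∃ p : S d × ℝ, T i = {p.1} ×ˢ Ioi p.2 := by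
    obtain ⟨_, ⟨x, rfl⟩, _, ⟨s, rfl⟩, h⟩ := hT i (mem_univ i)
    exact ⟨(x, s), h.symm⟩
  choose p hp using hT'
  have hTm : MeasurableSet (univ.pi T) := MeasurableSet.univ_pi fun i ↦ by
    rw [hp i]; exact (measurableSet_singleton _).prod measurableSet_Ioi
  set X : Traj d := fun k ↦ if h : k < n then p ⟨k, h⟩ else 0 with hX
  have hXp (i : Fin n) : X i = p i := by simp [hX]
  rw [Measure.map_apply (by fun_prop) hTm, Measure.map_apply (by fun_prop) hTm,
    Measure.restrict_apply ((show Measurable fun (ω : Ω d) (i : Fin n) ↦ traj ω i by fun_prop) hTm)]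
  have h1 := hP.2 n (fun i ↦ (X i).1) (fun i ↦ max (X i).2 0) fun _ ↦ le_max_right _ _
  have h2 := walkMeasure_cylinder hd hφ X n
  convert h1.trans (Eq.trans ?_ h2.symm) using 2
  · ext ω
    simp only [mem_inter_iff, mem_preimage, Set.mem_pi, mem_univ, true_imp_iff, hp, ← hXp, mem_prod,
      mem_singleton_iff, mem_Ioi, mem_ofPred_eq, traj, max_lt_iff]
    grind
  · ext y
    simp only [mem_preimage, Set.mem_pi, mem_univ, true_imp_iff, hp, ← hXp, mem_prod,
      mem_singleton_iff, mem_Ioi, mem_ofPred_eq]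
    exact ⟨fun h k hk ↦ h ⟨k, hk⟩, fun h i ↦ h i i.2⟩
  · rw [← Fin.prod_univ_eq_prod_range (fun k ↦
      (jumpRate d φ (X.state k) (X.state (k + 1)) / totalRate d φ (X.state k)
          * Real.exp (-totalRate d φ (X.state k) * max (X k).2 0)))]
    congr 1
    refine Finset.prod_congr rfl fun i _ ↦ ?_
    rw [chain_eq_state X i.2]
    rfl

theorem IsRWRCLaw.ae_start_and_pos {P : Measure (Ω d)} (hP : IsRWRCLaw d φ P) (hd : 1 ≤ d)
    (hφ : ∀ x i, 0 < φ x i) : ∀ᵐ ω ∂P, ω.1 0 = 0 ∧ ∀ k, 0 < ω.2 k := by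
  have := hP.1
  have h (n : ℕ) : ∀ᵐ ω ∂P, ω.1 0 = 0 ∧ ∀ i : Fin n, 0 < ω.2 i := by
    have hmeas : MeasurableSet {ω : Ω d | ω.1 0 = 0 ∧ ∀ i : Fin n, 0 < ω.2 i} := by
      have h1 : MeasurableSet {ω : Ω d | ω.1 0 = 0} :=
        (show Measurable fun ω : Ω d ↦ ω.1 0 by fun_prop) (measurableSet_singleton (0 : S d))
      have h2 : MeasurableSet {ω : Ω d | ∀ i : Fin n, 0 < ω.2 i} := by
        simp only [Set.ofPred_forall]
        exact MeasurableSet.iInter fun i ↦ measurableSet_lt measurable_const (by fun_prop)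
      exact h1.inter h2
    have := isProbabilityMeasure_walkMeasure hd hφ n
    have h1 := congrArg (fun m ↦ m univ) (hP.map_restrict hd hφ n)
    simp only [Measure.map_apply (show Measurable fun (ω : Ω d) (i : Fin n) ↦ traj ω i by fun_prop)
      MeasurableSet.univ, Measure.map_apply
      (show Measurable fun (y : Traj d) (i : Fin n) ↦ y i by fun_prop) MeasurableSet.univ,
      preimage_univ, measure_univ, Measure.restrict_apply MeasurableSet.univ, univ_inter] at h1
    exact (prob_compl_eq_zero_iff hmeas).2 h1
  filter_upwards [ae_all_iff.2 h] with ω hω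
  exact ⟨(hω 0).1, fun k ↦ (hω (k + 1)).2 (Fin.last k)⟩

theorem IsRWRCLaw.map_traj_restrict {P : Measure (Ω d)} (hP : IsRWRCLaw d φ P) (hd : 1 ≤ d)
    (hφ : ∀ x i, 0 < φ x i) (n : ℕ) :
    P.map (fun ω (i : Fin n) ↦ traj ω i) = (walkMeasure φ n).map fun y (i : Fin n) ↦ y i := by
  rw [← hP.map_restrict hd hφ n, Measure.restrict_eq_self_of_ae_mem]
  filter_upwards [hP.ae_start_and_pos hd hφ] with ω hω
  exact ⟨hω.1, fun i ↦ hω.2 i⟩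

theorem IsRWRCLaw.map_traj_apply {P : Measure (Ω d)} (hP : IsRWRCLaw d φ P) (hd : 1 ≤ d)
    (hφ : ∀ x i, 0 < φ x i) {n : ℕ} {D : Set (Traj d)} (hD : MeasurableSet D)
    (hDn : ∀ y y' : Traj d, (∀ k < n, y k = y' k) → (y ∈ D ↔ y' ∈ D)) :
    P.map traj D = walkMeasure φ n D := by
  set e : (Fin n → S d × ℝ) → Traj d := fun h k ↦ if hk : k < n then h ⟨k, hk⟩ else 0 with he
  have hem : Measurable e := by
    refine measurable_pi_iff.2 fun k ↦ ?_
    by_cases hk : k < n <;> simp only [he, hk, dite_true, dite_false] <;> fun_prop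
  have hpre : D = (fun y (i : Fin n) ↦ y i) ⁻¹' (e ⁻¹' D) := by
    ext y
    exact hDn _ _ fun k hk ↦ by simp [he, hk]
  have h := congrArg (fun m ↦ m (e ⁻¹' D)) (hP.map_traj_restrict hd hφ n)
  rw [Measure.map_apply (by fun_prop) (hem hD), Measure.map_apply (by fun_prop) (hem hD),
    ← hpre] at h
  rw [← h, Measure.map_apply measurable_traj hD]
  conv_lhs => rw [hpre]
  rfl

theorem AgreeUpTo.trunc_apply {t : ℝ} {n : ℕ} {y y' : Traj d} (h : AgreeUpTo t n y y') {k : ℕ}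
    (hk : k < n) : y.trunc t k = y'.trunc t k := by
  simp only [Traj.trunc]
  by_cases h1 : y.clock (k + 1) ≤ t
  · have h2 := clock_congr (h.apply_eq hk h1)
    rw [if_pos h1, if_pos (h2 ▸ h1), h k hk (Or.inl h1)]
  · have h2 : ¬ y'.clock (k + 1) ≤ t := fun h2 ↦
      h1 (clock_congr (h.symm.apply_eq hk h2) ▸ h2)
    rw [if_neg h1, if_neg h2]

theorem map_trunc_traj_le {a b : S d → Fin d → ℝ} (hd : 1 ≤ d)
    (hb : ∀ x i, 0 < b x i) (hba : ∀ x i, b x i ≤ a x i) {c t : ℝ} (hc0 : 0 ≤ c) (ht : 0 ≤ t)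
    (hc : ∀ x, totalRate d a x ≤ totalRate d b x + c) {Pa Pb : Measure (Ω d)}
    (hPa : IsRWRCLaw d a Pa) (hPb : IsRWRCLaw d b Pb) :
    Pb.map (fun ω ↦ (traj ω).trunc t)
      ≤ ENNReal.ofReal (Real.exp (c * t)) • Pa.map fun ω ↦ (traj ω).trunc t := by
  have ha (x i) : 0 < a x i := (hb x i).trans_le (hba x i)
  have := hPa.1
  have := hPb.1
  have := Measure.smul_finite (Pa.map fun ω ↦ (traj ω).trunc t)
    (ENNReal.ofReal_ne_top (r := Real.exp (c * t)))
  refine measure_le_of_isSetAlgebra (isSetAlgebra_measurableCylinders (α := fun _ ↦ S d × ℝ))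
    generateFrom_measurableCylinders.symm fun D hD ↦ ?_
  rw [measurableCylinders_nat] at hD
  simp only [mem_iUnion, mem_singleton_iff] at hD
  obtain ⟨m, T, hT, rfl⟩ := hD
  have hDm : MeasurableSet (Traj.trunc t ⁻¹' cylinder (Finset.Iic m) T : Set (Traj d)) :=
    measurable_trunc t (hT.cylinder _)
  have hagree (y y' : Traj d) (h : AgreeUpTo t (m + 1) y y') :
      y ∈ Traj.trunc t ⁻¹' cylinder (Finset.Iic m) T
        ↔ y' ∈ Traj.trunc t ⁻¹' cylinder (Finset.Iic m) T := by
    simp only [mem_preimage, mem_cylinder]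
    have : (Finset.Iic m).restrict (y.trunc t) = (Finset.Iic m).restrict (y'.trunc t) := by
      ext1 k
      exact h.trunc_apply (Nat.lt_succ_of_le (Finset.mem_Iic.1 k.2))
    rw [this]
  have hmap {φ : S d → Fin d → ℝ} (hφ : ∀ x i, 0 < φ x i) {P : Measure (Ω d)}
      (hP : IsRWRCLaw d φ P) :
      P.map (fun ω ↦ (traj ω).trunc t) (cylinder (Finset.Iic m) T)
        = walkMeasure φ (m + 1) (Traj.trunc t ⁻¹' cylinder (Finset.Iic m) T) := by
    rw [← hP.map_traj_apply hd hφ hDm fun y y' h ↦ hagree y y' fun k hk _ ↦ h k hk,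
      Measure.map_apply (by fun_prop) (hT.cylinder _), Measure.map_apply (by fun_prop) hDm]
    rfl
  rw [Measure.smul_apply, hmap hb hPb, hmap ha hPa, ← lintegral_indicator_one hDm,
    ← lintegral_indicator_one hDm, smul_eq_mul,
    ← lintegral_const_mul _ (measurable_one.indicator hDm)]
  refine (lintegral_walkMeasure_le hd hb hba ht hc (m + 1) (measurable_one.indicator hDm)
    fun y y' h ↦ indicator_eq_indicator (hagree y y' h) rfl).trans ?_
  gcongr
  exact min_le_left _ _

theorem path_toΩ_trunc {ω : Ω d} (h0 : ω.1 0 = 0) (hpos : ∀ k, 0 < ω.2 k) {t u : ℝ}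
    (ht : 0 ≤ t) (hu : u ≤ t) : path d ((traj ω).trunc t).toΩ u = path d ω u := by
  have hclock (n : ℕ) : (traj ω).clock n = ∑ i ∈ Finset.range n, ω.2 i :=
    Finset.sum_congr rfl fun i _ ↦ max_eq_left (hpos i).le
  have htrunc {n : ℕ} (hn : (traj ω).clock n ≤ t) {k : ℕ} (hk : k < n) :
      (traj ω).trunc t k = traj ω k :=
    if_pos ((clock_mono _ hk).trans hn)
  have hsum (n : ℕ) : ∑ i ∈ Finset.range n, ((traj ω).trunc t i).2 ≤ u
      ↔ ∑ i ∈ Finset.range n, ω.2 i ≤ u := by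
    by_cases hn : (traj ω).clock n ≤ t
    · rw [Finset.sum_congr rfl fun i hi ↦ by rw [htrunc hn (Finset.mem_range.1 hi)]]
      rfl
    · refine iff_of_false ?_ (by rw [← hclock]; linarith)
      cases n with
      | zero => exact absurd (clock_zero (traj ω) ▸ ht) hn
      | succ n =>
        have hnonneg (i : ℕ) : 0 ≤ ((traj ω).trunc t i).2 := by
          unfold Traj.trunc
          split_ifs
          · exact (hpos i).le
          · positivity
        have hlast : (traj ω).trunc t n = (0, t + 1) := if_neg hn
        have := Finset.sum_nonneg fun i (_ : i ∈ Finset.range n) ↦ hnonneg i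
        rw [Finset.sum_range_succ, hlast]
        simp only
        linarith
  have hset : {n : ℕ | ∑ i ∈ Finset.range n, ((traj ω).trunc t).toΩ.2 i ≤ u}
      = {n : ℕ | ∑ i ∈ Finset.range n, ω.2 i ≤ u} := Set.ext hsum
  unfold path
  rw [hset]
  set J := {n : ℕ | ∑ i ∈ Finset.range n, ω.2 i ≤ u}
  by_cases hJ : sSup J = 0
  · rw [hJ, h0]; rfl
  · have hmem : sSup J ∈ J := by
      refine Nat.sSup_mem ?_ ?_
      · by_contra hne
        exact hJ (by simp [not_nonempty_iff_eq_empty.1 hne])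
      · by_contra hbdd
        exact hJ (Nat.sSup_of_not_bddAbove hbdd)
    obtain ⟨n, hn⟩ := Nat.exists_eq_succ_of_ne_zero hJ
    rw [hn] at hmem ⊢
    have hle : (traj ω).clock (n + 1) ≤ t := (hclock _).trans_le (le_trans hmem hu)
    exact congrArg Prod.fst (htrunc hle n.lt_succ_self)

end Law

/-- Change-of-measure estimate: if `ψ - ε ≤ a ≤ ψ + ε` (with `ψ - ε > 0`),
then for any event depending on the path only up to time `t`,
`P_0^a(F) ≥ e^{-4dεt} P_0^{ψ-ε}(F)`. -/
theorem change_of_conductances (d : ℕ) (hd : 1 ≤ d)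
    (ψ a : S d → Fin d → ℝ) (ε t : ℝ) (hε : 0 < ε) (ht : 0 ≤ t)
    (hlow : ∀ x i, 0 < ψ x i - ε)
    (hbound : ∀ x i, ψ x i - ε ≤ a x i ∧ a x i ≤ ψ x i + ε)
    (Pa Pb : Measure (Ω d))
    (hPa : IsRWRCLaw d a Pa) (hPb : IsRWRCLaw d (fun x i => ψ x i - ε) Pb)
    (A : Set (ℝ → S d))
    (hA : ∀ f g : ℝ → S d, (∀ u ∈ Set.Icc (0 : ℝ) t, f u = g u) → (f ∈ A ↔ g ∈ A)) :
    Pb {ω | path d ω ∈ A}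
      ≤ ENNReal.ofReal (Real.exp (4 * d * ε * t)) * Pa {ω | path d ω ∈ A} := by
  set b : S d → Fin d → ℝ := fun x i ↦ ψ x i - ε
  have hba (x i) : b x i ≤ a x i := (hbound x i).1
  have ha (x i) : 0 < a x i := (hlow x i).trans_le (hba x i)
  have hrate (x) : totalRate d a x ≤ totalRate d b x + 4 * d * ε := by
    have hsum : ∑ i : Fin d, (a x i + a (x - Pi.single i 1) i)
        ≤ ∑ i : Fin d, ((b x i + b (x - Pi.single i 1) i) + 4 * ε) :=
      Finset.sum_le_sum fun i _ ↦ by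
        have h1 := (hbound x i).2
        have h2 := (hbound (x - Pi.single i 1) i).2
        simp only [b]
        linarith
    rw [Finset.sum_add_distrib (g := fun _ ↦ 4 * ε), Finset.sum_const, Finset.card_univ,
      Fintype.card_fin, nsmul_eq_mul] at hsum
    unfold totalRate
    linarith
  have := hPa.1
  set f : Ω d → Traj d := fun ω ↦ (traj ω).trunc t
  have hf : Measurable f := by fun_prop
  set B : Set (Traj d) := {y | path d y.toΩ ∈ A}
  have hB {φ : S d → Fin d → ℝ} (hφ : ∀ x i, 0 < φ x i) {P : Measure (Ω d)}
      (hP : IsRWRCLaw d φ P) : P {ω | path d ω ∈ A} = P (f ⁻¹' B) := by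
    refine measure_congr ?_
    filter_upwards [hP.ae_start_and_pos hd hφ] with ω hω
    exact propext (hA _ _ fun u hu ↦ (path_toΩ_trunc hω.1 hω.2 ht hu.2).symm)
  rw [hB hlow hPb, hB ha hPa]
  calc Pb (f ⁻¹' B) ≤ Pb.map f B := Measure.le_map_apply hf.aemeasurable B
    _ ≤ (ENNReal.ofReal (Real.exp (4 * d * ε * t)) • Pa.map f) B :=
        map_trunc_traj_le hd hlow hba (by positivity) ht hrate hPa hPb B
    _ ≤ ENNReal.ofReal (Real.exp (4 * d * ε * t)) * Pa (f ⁻¹' B) := by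
        rw [Measure.smul_apply, smul_eq_mul]
        gcongr
        exact map_apply_le_preimage Pa hf B

end RWRC
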